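/- arXiv:1809.00630 — 2 statements merged into one kernel-verified Lean document; each statement's English description precedes it below -/
import Mathlib

section
/- (Main theorem.) Let X = ⋂_{n=0}^∞ (Xₙ, ‖·‖ₙ) and Y = ⋂_{n=0}^∞ (Yₙ, |·|ₙ) be compactly graded spaces. Let f : X → Y be continuous (with respect to the metrics ρ_X, ρ_Y), directionally differentiable at every point, and satisfy f(0) = 0. Assume there are constants cₙ > 0 (n ≥ 0) and d ∈ {0} ∪ ℕ such that for each x ∈ X and each v ∈ Y there exists u ∈ X with f'(x; u) = v and ‖u‖ₙ ≤ cₙ|v|_{n+d} for all n ≥ 0. Then for each y ∈ Y there exists x ∈ X such that f(x) = y and ‖x‖ₙ ≤ cₙ|y|_{n+d} for all n ≥ 0. -/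
open Filter Topology
open scoped ENNReal

noncomputable section

/-- Monotonicity of `t ↦ t / (1 + t)` on nonnegative reals. -/
lemma gradedG_mono {a b : ℝ} (ha : 0 ≤ a) (hab : a ≤ b) :
    a / (1 + a) ≤ b / (1 + b) := by
  rw [div_le_div_iff₀ (by linarith) (by linarith)]
  nlinarith

/-- Subadditivity of `t ↦ t / (1 + t)` on nonnegative reals. -/
lemma gradedG_subadd {a b : ℝ} (ha : 0 ≤ a) (hb : 0 ≤ b) :
    (a + b) / (1 + (a + b)) ≤ a / (1 + a) + b / (1 + b) := by
  have h1 : (0:ℝ) < 1 + a := by linarith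
  have h2 : (0:ℝ) < 1 + b := by linarith
  have h3 : (0:ℝ) < 1 + (a + b) := by linarith
  rw [div_add_div _ _ h1.ne' h2.ne', div_le_div_iff₀ h3 (by positivity)]
  nlinarith [mul_nonneg ha hb, mul_nonneg (mul_nonneg ha hb) ha,
    mul_nonneg (mul_nonneg ha hb) hb]

variable (E : ℕ → Type) [∀ n, NormedAddCommGroup (E n)] [∀ n, NormedSpace ℝ (E n)]
variable (J : ∀ n, E (n + 1) →L[ℝ] E n)

/-- The inverse limit `X = ⋂ₙ Xₙ` of the system of inclusions `Jₙ : Xₙ₊₁ → Xₙ`,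
as a submodule of the product `∏ₙ Xₙ`. -/
def invLimSubmodule : Submodule ℝ (∀ n, E n) where
  carrier := {x | ∀ n, J n (x (n + 1)) = x n}
  add_mem' := by intro a b ha hb n; simp [ha n, hb n]
  zero_mem' := by intro n; simp
  smul_mem' := by intro c a ha n; simp [ha n]

/-- The inverse limit as a type; its elements carry all the norms `‖x.1 n‖`. -/
def InvLim : Type _ := ↥(invLimSubmodule E J)

instance : AddCommGroup (InvLim E J) :=
  inferInstanceAs (AddCommGroup ↥(invLimSubmodule E J))

instance : Module ℝ (InvLim E J) :=
  inferInstanceAs (Module ℝ ↥(invLimSubmodule E J))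

variable {E J}

/-- `n`-th term in the defining formula for the metric `ρ_X`. -/
def rhoTerm (x y : InvLim E J) (n : ℕ) : ℝ :=
  (2 : ℝ)⁻¹ ^ n * (‖x.1 n - y.1 n‖ / (1 + ‖x.1 n - y.1 n‖))

/-- The translation-invariant metric
`ρ_X(x,y) = max_n 2⁻ⁿ ‖x-y‖ₙ / (1 + ‖x-y‖ₙ)` on the inverse limit. -/
def rho (x y : InvLim E J) : ℝ := ⨆ n, rhoTerm x y n

lemma rhoTerm_nonneg (x y : InvLim E J) (n : ℕ) : 0 ≤ rhoTerm x y n := by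
  unfold rhoTerm; positivity

lemma rhoTerm_le_one (x y : InvLim E J) (n : ℕ) : rhoTerm x y n ≤ 1 := by
  unfold rhoTerm
  have h0 : (0:ℝ) ≤ ‖x.1 n - y.1 n‖ := norm_nonneg _
  have h1 : ‖x.1 n - y.1 n‖ / (1 + ‖x.1 n - y.1 n‖) ≤ 1 := by
    rw [div_le_one (by linarith)]; linarith
  have h2 : ((2:ℝ)⁻¹) ^ n ≤ 1 := pow_le_one₀ (by norm_num) (by norm_num)
  have h3 : (0:ℝ) ≤ ((2:ℝ)⁻¹) ^ n := by positivity
  nlinarith [div_nonneg h0 (by linarith : (0:ℝ) ≤ 1 + ‖x.1 n - y.1 n‖)]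

lemma rho_bddAbove (x y : InvLim E J) : BddAbove (Set.range (rhoTerm x y)) := by
  refine ⟨1, ?_⟩
  rintro r ⟨n, rfl⟩
  exact rhoTerm_le_one x y n

lemma rhoTerm_triangle (x y z : InvLim E J) (n : ℕ) :
    rhoTerm x z n ≤ rhoTerm x y n + rhoTerm y z n := by
  unfold rhoTerm
  set a := ‖x.1 n - y.1 n‖ with ha
  set b := ‖y.1 n - z.1 n‖ with hb
  have ha0 : 0 ≤ a := norm_nonneg _
  have hb0 : 0 ≤ b := norm_nonneg _
  have hxz : ‖x.1 n - z.1 n‖ ≤ a + b := by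
    simpa [dist_eq_norm, ha, hb] using dist_triangle (x.1 n) (y.1 n) (z.1 n)
  have step1 : ‖x.1 n - z.1 n‖ / (1 + ‖x.1 n - z.1 n‖) ≤ (a + b) / (1 + (a + b)) :=
    gradedG_mono (norm_nonneg _) hxz
  have step2 := gradedG_subadd ha0 hb0
  have hw : (0:ℝ) ≤ (2:ℝ)⁻¹ ^ n := by positivity
  calc (2:ℝ)⁻¹ ^ n * (‖x.1 n - z.1 n‖ / (1 + ‖x.1 n - z.1 n‖))
      ≤ (2:ℝ)⁻¹ ^ n * (a / (1 + a) + b / (1 + b)) :=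
        mul_le_mul_of_nonneg_left (step1.trans step2) hw
    _ = (2:ℝ)⁻¹ ^ n * (a / (1 + a)) + (2:ℝ)⁻¹ ^ n * (b / (1 + b)) := mul_add _ _ _

instance : MetricSpace (InvLim E J) where
  dist x y := rho x y
  dist_self x := by
    have h : ∀ n, rhoTerm x x n = 0 := by intro n; simp [rhoTerm]
    show rho x x = 0
    unfold rho
    simp [h]
  dist_comm x y := by
    show rho x y = rho y x
    unfold rho rhoTerm
    congr 1
    funext n
    rw [norm_sub_rev]
  dist_triangle x y z := by
    show rho x z ≤ rho x y + rho y z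
    refine ciSup_le fun n => ?_
    calc rhoTerm x z n ≤ rhoTerm x y n + rhoTerm y z n := rhoTerm_triangle x y z n
      _ ≤ rho x y + rho y z :=
        add_le_add (le_ciSup (rho_bddAbove x y) n) (le_ciSup (rho_bddAbove y z) n)
  eq_of_dist_eq_zero := by
    intro x y h
    have hxy : ∀ n, x.1 n = y.1 n := by
      intro n
      have h1 : rhoTerm x y n ≤ 0 := by
        have := le_ciSup (rho_bddAbove x y) n
        change rhoTerm x y n ≤ rho x y at this
        rwa [show rho x y = 0 from h] at this
      have h3 : rhoTerm x y n = 0 := le_antisymm h1 (rhoTerm_nonneg x y n)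
      unfold rhoTerm at h3
      have hw : (0:ℝ) < (2:ℝ)⁻¹ ^ n := by positivity
      have h4 : ‖x.1 n - y.1 n‖ / (1 + ‖x.1 n - y.1 n‖) = 0 := by
        rcases mul_eq_zero.1 h3 with h | h
        · exact absurd h hw.ne'
        · exact h
      have hd : (0:ℝ) < 1 + ‖x.1 n - y.1 n‖ := by positivity
      have h5 : ‖x.1 n - y.1 n‖ = 0 := by
        rcases div_eq_zero_iff.1 h4 with h' | h'
        · exact h'
        · exact absurd h' hd.ne'
      have := norm_eq_zero.1 h5
      exact sub_eq_zero.1 this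
    exact Subtype.ext (funext hxy)

variable (E J)

/-- `Π_s(X) = {x ∈ X : ‖x‖ₙ ≤ sₙ for all n}`. -/
def PiSet (s : ℕ → ℝ) : Set (InvLim E J) := {x | ∀ n, ‖x.1 n‖ ≤ s n}

end

section InvLim

variable {E : ℕ → Type} [∀ n, NormedAddCommGroup (E n)] [∀ n, NormedSpace ℝ (E n)]
variable {J : ∀ n, E (n + 1) →L[ℝ] E n}

lemma InvLim.continuous_coord (n : ℕ) : Continuous fun x : InvLim E J => x.1 n := by
  refine Metric.continuous_iff.2 fun x ε hε => ⟨(2 : ℝ)⁻¹ ^ n * (ε / (1 + ε)), by positivity, ?_⟩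
  intro z hz
  by_contra! hle
  rw [dist_eq_norm] at hle
  have h1 : rhoTerm z x n ≤ dist z x := le_ciSup (rho_bddAbove z x) n
  have h2 : (2 : ℝ)⁻¹ ^ n * (ε / (1 + ε)) ≤ rhoTerm z x n :=
    mul_le_mul_of_nonneg_left (gradedG_mono hε.le hle) (by positivity)
  linarith

lemma rhoTerm_le_norm (x z : InvLim E J) (n : ℕ) : rhoTerm x z n ≤ ‖x.1 n - z.1 n‖ := by
  have h0 := norm_nonneg (x.1 n - z.1 n)
  have h1 : ‖x.1 n - z.1 n‖ / (1 + ‖x.1 n - z.1 n‖) ≤ ‖x.1 n - z.1 n‖ :=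
    div_le_self h0 (by linarith)
  have h2 : ((2 : ℝ)⁻¹) ^ n ≤ 1 := pow_le_one₀ (by norm_num) (by norm_num)
  exact (mul_le_of_le_one_left (by positivity) h2).trans h1

lemma rhoTerm_le_pow (x z : InvLim E J) (n : ℕ) : rhoTerm x z n ≤ (2 : ℝ)⁻¹ ^ n := by
  have h0 := norm_nonneg (x.1 n - z.1 n)
  refine mul_le_of_le_one_right (by positivity) ?_
  rw [div_le_one (by linarith)]
  linarith

/-- The metric `ρ_X` induces the topology of coordinatewise convergence. -/
lemma InvLim.isInducing_val :
    IsInducing (fun x : InvLim E J => (x.1 : ∀ n, E n)) := by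
  refine isInducing_iff_nhds.2 fun x => le_antisymm ?_ ?_
  · exact ((continuous_pi fun n => InvLim.continuous_coord n).tendsto x).le_comap
  · refine Metric.nhds_basis_ball.ge_iff.2 fun ε hε => ?_
    obtain ⟨N, hN⟩ := exists_pow_lt_of_lt_one (half_pos hε) (by norm_num : (2 : ℝ)⁻¹ < 1)
    have hcoord : ∀ n, ∀ᶠ z in comap (fun x : InvLim E J => (x.1 : ∀ n, E n)) (𝓝 x.1),
        ‖z.1 n - x.1 n‖ < ε / 2 := fun n => by
      have ht : Tendsto (fun z : InvLim E J => z.1 n)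
          (comap (fun x : InvLim E J => (x.1 : ∀ n, E n)) (𝓝 x.1)) (𝓝 (x.1 n)) :=
        ((continuous_apply n).tendsto x.1).comp tendsto_comap
      filter_upwards [ht (Metric.ball_mem_nhds _ (half_pos hε))] with z hz
      simpa [dist_eq_norm] using hz
    filter_upwards [(Finset.range N).eventually_all.2 fun n _ => hcoord n] with z hz
    refine lt_of_le_of_lt (ciSup_le fun n => ?_ : rho z x ≤ ε / 2) (half_lt_self hε)
    by_cases hn : n < N
    · exact (rhoTerm_le_norm z x n).trans (hz n (Finset.mem_range.2 hn)).le
    · exact (rhoTerm_le_pow z x n).trans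
        ((pow_le_pow_of_le_one (by norm_num) (by norm_num) (not_lt.1 hn)).trans hN.le)

lemma isCompact_PiSet (hJcpt : ∀ n, IsCompactOperator (J n)) (s : ℕ → ℝ) :
    IsCompact (PiSet E J s) := by
  rw [InvLim.isInducing_val.isCompact_iff]
  have himage : (fun x : InvLim E J => (x.1 : ∀ n, E n)) '' PiSet E J s =
      ⋂ n, {x | J n (x (n + 1)) = x n} ∩ {x | ‖x n‖ ≤ s n} := by
    ext x
    simp only [Set.mem_image, Set.mem_iInter, Set.mem_inter_iff, Set.mem_ofPred_eq]
    constructor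
    · rintro ⟨z, hz, rfl⟩ n
      exact ⟨z.2 n, hz n⟩
    · intro h
      exact ⟨⟨x, fun n => (h n).1⟩, fun n => (h n).2, rfl⟩
  have hcompact : IsCompact (Set.univ.pi fun n =>
      closure (J n '' Metric.closedBall 0 (s (n + 1)))) :=
    isCompact_univ_pi fun n => (hJcpt n).isCompact_closure_image_closedBall (s (n + 1))
  rw [himage]
  refine hcompact.of_isClosed_subset ?_ ?_
  · refine isClosed_iInter fun n => IsClosed.inter ?_ ?_
    · exact isClosed_eq ((J n).continuous.comp (continuous_apply _)) (continuous_apply _)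
    · exact isClosed_le (continuous_apply n).norm continuous_const
  · intro x hx n _
    simp only [Set.mem_iInter, Set.mem_inter_iff, Set.mem_ofPred_eq] at hx
    exact subset_closure ⟨x (n + 1), by simpa using (hx (n + 1)).2, (hx n).1⟩

end InvLim

section ApproximateSolution

variable {E : ℕ → Type} [∀ n, NormedAddCommGroup (E n)] [∀ n, NormedSpace ℝ (E n)]
variable {J : ∀ n, E (n + 1) →L[ℝ] E n}
variable {F : ℕ → Type} [∀ n, NormedAddCommGroup (F n)] [∀ n, NormedSpace ℝ (F n)]
variable {K : ∀ n, F (n + 1) →L[ℝ] F n}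

/-- If at each point the direction `y` is a directional derivative of `f` along some element of
`Π_s`, then `y` is approximated in finitely many norms by values of `f` on `Π_s`. -/
lemma exists_mem_PiSet_norm_sub_le
    (hJcpt : ∀ n, IsCompactOperator (J n))
    {f : InvLim E J → InvLim F K} (hf : Continuous f) (hf0 : f 0 = 0)
    {s : ℕ → ℝ} (hs : ∀ n, 0 ≤ s n) {y : InvLim F K}
    (hsol : ∀ x : InvLim E J, ∃ u ∈ PiSet E J s,
      Tendsto (fun t : ℝ => t⁻¹ • (f (x + t • u) - f x)) (𝓝[>] (0 : ℝ)) (𝓝 y))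
    (N : ℕ) {ε : ℝ} (hε : 0 < ε) :
    ∃ x ∈ PiSet E J s, ∀ m < N, ‖(f x).1 m - y.1 m‖ ≤ ε := by
  let S : Set (ℝ × InvLim E J) := {p | p.1 ∈ Set.Icc (0 : ℝ) 1 ∧ p.2 ∈ PiSet E J s ∧
    (∀ n, ‖p.2.1 n‖ ≤ p.1 * s n) ∧ ∀ m < N, ‖(f p.2).1 m - p.1 • y.1 m‖ ≤ ε * p.1}
  have hSclosed : IsClosed {p : ℝ × InvLim E J |
      (∀ n, ‖p.2.1 n‖ ≤ p.1 * s n) ∧ ∀ m < N, ‖(f p.2).1 m - p.1 • y.1 m‖ ≤ ε * p.1} := by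
    simp only [Set.ofPred_and, Set.ofPred_forall]
    refine (isClosed_iInter fun n => isClosed_le ?_ (by fun_prop)).inter
      (isClosed_iInter fun m => isClosed_iInter fun _ => isClosed_le ?_ (by fun_prop))
    · exact ((InvLim.continuous_coord n).comp continuous_snd).norm
    · exact (((InvLim.continuous_coord m).comp (hf.comp continuous_snd)).sub
        (continuous_fst.smul continuous_const)).norm
  have hScompact : IsCompact S := by
    have heq : S = (Set.Icc (0 : ℝ) 1 ×ˢ PiSet E J s) ∩ {p : ℝ × InvLim E J |
        (∀ n, ‖p.2.1 n‖ ≤ p.1 * s n) ∧ ∀ m < N, ‖(f p.2).1 m - p.1 • y.1 m‖ ≤ ε * p.1} := by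
      ext p
      simp only [S, Set.mem_inter_iff, Set.mem_prod, Set.mem_ofPred_eq, and_assoc]
    rw [heq]
    exact (isCompact_Icc.prod (isCompact_PiSet hJcpt s)).inter_right hSclosed
  have hzero : ((0, 0) : ℝ × InvLim E J) ∈ S := by
    have h0 : ∀ n, (0 : InvLim E J).1 n = 0 := fun _ => rfl
    have h0' : ∀ n, (0 : InvLim F K).1 n = 0 := fun _ => rfl
    refine ⟨by simp, fun n => ?_, fun n => ?_, fun m _ => ?_⟩
    · simpa [h0] using hs n
    · simp [h0]
    · simp [hf0, h0']
  obtain ⟨⟨t, x⟩, ⟨ht, hxs, hx, hfx⟩, hmax⟩ :=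
    hScompact.exists_isMaxOn ⟨_, hzero⟩ continuous_fst.continuousOn
  simp only at ht hxs hx hfx
  rcases ht.2.eq_or_lt with rfl | ht1
  · exact ⟨x, hxs, by simpa using hfx⟩
  exfalso
  obtain ⟨u, hu, hlim⟩ := hsol x
  have hcoord : ∀ m, ∀ᶠ r : ℝ in 𝓝[>] (0 : ℝ),
      ‖r⁻¹ • ((f (x + r • u)).1 m - (f x).1 m) - y.1 m‖ < ε := fun m => by
    filter_upwards [((InvLim.continuous_coord m).tendsto y).comp hlim
      (Metric.ball_mem_nhds _ hε)] with r hr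
    rw [← dist_eq_norm]
    exact hr
  obtain ⟨r, hr, hr0, hr1⟩ := (((Finset.range N).eventually_all.2 fun m _ => hcoord m).and
    (Ioo_mem_nhdsGT (sub_pos.2 ht1))).exists
  have hxu : ∀ n, ‖(x + r • u).1 n‖ ≤ (t + r) * s n := fun n => by
    calc ‖(x + r • u).1 n‖ = ‖x.1 n + r • u.1 n‖ := rfl
      _ ≤ ‖x.1 n‖ + ‖r • u.1 n‖ := norm_add_le _ _
      _ ≤ t * s n + r * s n := by
        rw [norm_smul, Real.norm_of_nonneg hr0.le]
        exact add_le_add (hx n) (mul_le_mul_of_nonneg_left (hu n) hr0.le)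
      _ = (t + r) * s n := by ring
  have hmem : (t + r, x + r • u) ∈ S := by
    refine ⟨⟨by linarith [ht.1], by linarith⟩, fun n => ?_, hxu, fun m hm => ?_⟩
    · exact (hxu n).trans (mul_le_of_le_one_left (hs n) (by linarith))
    · have hstep : (f (x + r • u)).1 m - (t + r) • y.1 m = ((f x).1 m - t • y.1 m) +
          r • (r⁻¹ • ((f (x + r • u)).1 m - (f x).1 m) - y.1 m) := by
        rw [smul_sub, smul_inv_smul₀ hr0.ne', add_smul]
        abel
      calc ‖(f (x + r • u)).1 m - (t + r) • y.1 m‖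
          ≤ ‖(f x).1 m - t • y.1 m‖ +
            ‖r • (r⁻¹ • ((f (x + r • u)).1 m - (f x).1 m) - y.1 m)‖ := by
            rw [hstep]; exact norm_add_le _ _
        _ ≤ ε * t + r * ε := by
            rw [norm_smul, Real.norm_of_nonneg hr0.le]
            exact add_le_add (hfx m hm)
              (mul_le_mul_of_nonneg_left (hr m (Finset.mem_range.2 hm)).le hr0.le)
        _ = ε * (t + r) := by ring
  have hle : t + r ≤ t := hmax hmem
  linarith

end ApproximateSolution

/-- Main theorem: let `X`, `Y` be compactly graded spaces, `f : X → Y`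
continuous, directionally differentiable, `f(0) = 0`, and assume the derivative
surjectivity estimate with constants `cₙ > 0` and shift `d`. Then for each `y ∈ Y` there
is `x ∈ X` with `f(x) = y` and `‖x‖ₙ ≤ cₙ|y|_{n+d}` for all `n`. -/
theorem nash_moser_ekeland
    (E : ℕ → Type) [∀ n, NormedAddCommGroup (E n)] [∀ n, NormedSpace ℝ (E n)]
    [∀ n, CompleteSpace (E n)]
    (J : ∀ n, E (n + 1) →L[ℝ] E n)
    (hJinj : ∀ n, Function.Injective (J n))
    (hJcpt : ∀ n, IsCompactOperator (J n))
    (F : ℕ → Type) [∀ n, NormedAddCommGroup (F n)] [∀ n, NormedSpace ℝ (F n)]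
    [∀ n, CompleteSpace (F n)]
    (K : ∀ n, F (n + 1) →L[ℝ] F n)
    (hKinj : ∀ n, Function.Injective (K n))
    (hKcpt : ∀ n, IsCompactOperator (K n))
    (f : InvLim E J → InvLim F K) (hf : Continuous f) (hf0 : f 0 = 0)
    (D : InvLim E J → InvLim E J → InvLim F K)
    (hD : ∀ x h : InvLim E J,
      Tendsto (fun t : ℝ => t⁻¹ • (f (x + t • h) - f x)) (𝓝[>] (0 : ℝ)) (𝓝 (D x h)))
    (c : ℕ → ℝ) (hc : ∀ n, 0 < c n)
    (d : ℕ)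
    (hsol : ∀ x : InvLim E J, ∀ v : InvLim F K,
      ∃ u : InvLim E J, D x u = v ∧ ∀ n, ‖u.1 n‖ ≤ c n * ‖v.1 (n + d)‖)
    (y : InvLim F K) :
    ∃ x : InvLim E J, f x = y ∧ ∀ n, ‖x.1 n‖ ≤ c n * ‖y.1 (n + d)‖ := by
  have hs : ∀ n, 0 ≤ c n * ‖y.1 (n + d)‖ := fun n => mul_nonneg (hc n).le (norm_nonneg _)
  have hdir : ∀ x : InvLim E J, ∃ u ∈ PiSet E J fun n => c n * ‖y.1 (n + d)‖,
      Tendsto (fun t : ℝ => t⁻¹ • (f (x + t • u) - f x)) (𝓝[>] (0 : ℝ)) (𝓝 y) := fun x => by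
    obtain ⟨u, hu, hun⟩ := hsol x y
    exact ⟨u, hun, hu ▸ hD x u⟩
  choose x hx hfx using fun N : ℕ =>
    exists_mem_PiSet_norm_sub_le hJcpt hf hf0 hs hdir N (Nat.one_div_pos_of_nat (α := ℝ) (n := N))
  obtain ⟨a, ha, φ, hφ, hlim⟩ := (isCompact_PiSet hJcpt _).tendsto_subseq hx
  refine ⟨a, Subtype.ext (funext fun m => ?_), ha⟩
  have h1 : Tendsto (fun k => (f (x (φ k))).1 m) atTop (𝓝 ((f a).1 m)) :=
    (((InvLim.continuous_coord m).comp hf).tendsto a).comp hlim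
  have h2 : Tendsto (fun k => (f (x (φ k))).1 m) atTop (𝓝 (y.1 m)) := by
    rw [tendsto_iff_norm_sub_tendsto_zero]
    refine squeeze_zero' (Eventually.of_forall fun _ => norm_nonneg _) ?_
      (tendsto_one_div_add_atTop_nhds_zero_nat.comp hφ.tendsto_atTop)
    filter_upwards [eventually_gt_atTop m] with k hk
    exact hfx (φ k) m (hk.trans_le (hφ.id_le k))
  exact tendsto_nhds_unique h1 h2
end

section
/- (Heine–Borel variant of the main theorem.) Let X be a real vector space with a sequence of norms (‖·‖ₙ)ₙ₌₀^∞ and Y a real vector space with a sequence of norms (|·|ₙ)ₙ₌₀^∞, each complete with respect to the corresponding metric ρ_X(x,y) := max_{n≥0} 2^{-n}‖x−y‖ₙ/(1+‖x−y‖ₙ) (resp. ρ_Y), and assume both X and Y have the Heine–Borel property: every subset closed in the metric and bounded in each norm is compact. Let f : X → Y be continuous (with respect to ρ_X, ρ_Y), directionally differentiable at every point, and satisfy f(0) = 0. Assume there are constants cₙ > 0 (n ≥ 0) and d ∈ {0} ∪ ℕ such that for each x ∈ X and each v ∈ Y there exists u ∈ X with f'(x; u) = v and ‖u‖ₙ ≤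 cₙ|v|_{n+d} for all n ≥ 0. Then for each y ∈ Y there exists x ∈ X such that f(x) = y and ‖x‖ₙ ≤ cₙ|y|_{n+d} for all n ≥ 0. -/
open Filter Topology

/-- If a nonnegative function `p` of differences is dominated, through `2⁻ⁿ p / (1 + p)`, by the
distance, then `p (a - b)` tends to `0` as `a` tends to `b`. -/
lemma tendsto_sub_of_weighted_le_dist {X : Type*} [AddCommGroup X] [MetricSpace X]
    {p : X → ℝ} (p_nonneg : ∀ x, 0 ≤ p x) (n : ℕ)
    (h : ∀ x y : X, (2 : ℝ)⁻¹ ^ n * (p (x - y) / (1 + p (x - y))) ≤ dist x y) (b : X) :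
    Tendsto (fun a => p (a - b)) (𝓝 b) (𝓝 0) := by
  refine Metric.tendsto_nhds_nhds.2 fun ε hε => ⟨(2 : ℝ)⁻¹ ^ n * (ε / (1 + ε)), by positivity, ?_⟩
  intro a ha
  have hlt := lt_of_mul_lt_mul_left ((h a b).trans_lt ha) (by positivity)
  have hnn := p_nonneg (a - b)
  rw [div_lt_div_iff₀ (by positivity) (by positivity)] at hlt
  rw [Real.dist_0_eq_abs, abs_of_nonneg hnn]
  linarith

/-- A seminorm `q` satisfying `q (a - b) → 0` as `a → b` is continuous. -/
lemma Seminorm.continuous_of_tendsto_sub {X : Type*} [AddCommGroup X] [Module ℝ X]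
    [TopologicalSpace X] (q : Seminorm ℝ X)
    (h : ∀ b, Tendsto (fun a => q (a - b)) (𝓝 b) (𝓝 0)) : Continuous q :=
  continuous_iff_continuousAt.2 fun b => tendsto_iff_dist_tendsto_zero.2 <|
    squeeze_zero (fun _ => dist_nonneg)
      (fun a => by rw [Real.dist_eq]; exact abs_sub_map_le_sub q a b) (h b)

/-- Continuation along the segment `t • y`, `0 ≤ t ≤ 1`: inside a compact set of admissible
points, `y` is attained up to an arbitrary error, measured by a seminorm `q`. -/
lemma exists_approx_preimage {ι X Y : Type*} [AddCommGroup X] [Module ℝ X] [TopologicalSpace X]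
    [AddCommGroup Y] [Module ℝ Y] {N : ι → Seminorm ℝ X} (hN : ∀ n, Continuous (N n))
    {q : Seminorm ℝ Y} {f : X → Y} (hf : ∀ x, Tendsto (fun z => q (f z - f x)) (𝓝 x) (𝓝 0))
    (hf0 : f 0 = 0) {y : Y} {b : ι → ℝ} (hb : ∀ n, 0 ≤ b n)
    (hC : IsCompact {x | ∀ n, N n x ≤ b n})
    (hstep : ∀ x, ∃ u, (∀ n, N n u ≤ b n) ∧
      Tendsto (fun t : ℝ => q (t⁻¹ • (f (x + t • u) - f x) - y)) (𝓝[>] 0) (𝓝 0))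
    {ε : ℝ} (hε : 0 < ε) :
    ∃ x, (∀ n, N n x ≤ b n) ∧ q (f x - y) ≤ ε := by
  have hcont : Continuous fun z : X × ℝ => q (f z.1 - z.2 • y) := by
    refine continuous_iff_continuousAt.2 fun z => tendsto_iff_dist_tendsto_zero.2 ?_
    have hlim : Tendsto (fun w : X × ℝ => q (f w.1 - f z.1) + |w.2 - z.2| * q y) (𝓝 z) (𝓝 0) := by
      have h₁ := (hf z.1).comp (continuous_fst.tendsto z)
      have h₂ : Tendsto (fun w : X × ℝ => |w.2 - z.2| * q y) (𝓝 z) (𝓝 (|z.2 - z.2| * q y)) :=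
        Continuous.tendsto (by fun_prop) z
      simpa using h₁.add h₂
    refine squeeze_zero (fun _ => dist_nonneg) (fun w => ?_) hlim
    calc dist (q (f w.1 - w.2 • y)) (q (f z.1 - z.2 • y))
        ≤ q ((f w.1 - w.2 • y) - (f z.1 - z.2 • y)) := by
          rw [Real.dist_eq]; exact abs_sub_map_le_sub q _ _
      _ = q ((f w.1 - f z.1) - (w.2 - z.2) • y) := by congr 1; module
      _ ≤ q (f w.1 - f z.1) + q ((w.2 - z.2) • y) := map_sub_le_add q _ _
      _ = q (f w.1 - f z.1) + |w.2 - z.2| * q y := by rw [map_smul_eq_mul, Real.norm_eq_abs]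
  set K : Set (X × ℝ) := {z | z.2 ∈ Set.Icc 0 1 ∧ (∀ n, N n z.1 ≤ z.2 * b n) ∧
    q (f z.1 - z.2 • y) ≤ ε * z.2} with hK
  have hclosed : IsClosed K := by
    refine (isClosed_Icc.preimage continuous_snd).inter (IsClosed.inter ?_ ?_)
    · change IsClosed {z : X × ℝ | ∀ n, N n z.1 ≤ z.2 * b n}
      simp only [Set.ofPred_forall]
      exact isClosed_iInter fun n =>
        isClosed_le ((hN n).comp continuous_fst) (continuous_snd.mul continuous_const)
    · exact isClosed_le hcont (continuous_const.mul continuous_snd)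
  have hcompact : IsCompact K :=
    (hC.prod (isCompact_Icc (a := (0 : ℝ)) (b := 1))).of_isClosed_subset hclosed
      fun z hz => ⟨fun n => (hz.2.1 n).trans (mul_le_of_le_one_left (hb n) hz.1.2), hz.1⟩
  have hne : K.Nonempty := ⟨(0, 0), by simp [hK, hf0]⟩
  obtain ⟨⟨x, t⟩, ⟨⟨ht0, ht1⟩, hxN, hxq⟩, hmax⟩ :=
    hcompact.exists_isMaxOn hne continuous_snd.continuousOn
  dsimp only at ht0 ht1 hxN hxq
  rcases ht1.eq_or_lt with rfl | hlt
  · exact ⟨x, by simpa using hxN, by simpa using hxq⟩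
  obtain ⟨u, huN, hu⟩ := hstep x
  obtain ⟨s, hsq, hs0, hs1⟩ := ((hu.eventually (eventually_lt_nhds hε)).and
    (Ioo_mem_nhdsGT (sub_pos.2 hlt))).exists
  have hmem : (x + s • u, t + s) ∈ K := by
    refine ⟨⟨by positivity, by dsimp only; linarith⟩, fun n => ?_, ?_⟩
    · calc N n (x + s • u) ≤ N n x + N n (s • u) := map_add_le_add _ _ _
        _ = N n x + s * N n u := by rw [map_smul_eq_mul, Real.norm_of_nonneg hs0.le]
        _ ≤ t * b n + s * b n := by gcongr; exacts [hxN n, huN n]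
        _ = (t + s) * b n := by ring
    · have hsplit : f (x + s • u) - (t + s) • y =
          (f x - t • y) + s • (s⁻¹ • (f (x + s • u) - f x) - y) := by
        rw [smul_sub, smul_inv_smul₀ hs0.ne']; module
      calc q (f (x + s • u) - (t + s) • y)
          ≤ q (f x - t • y) + q (s • (s⁻¹ • (f (x + s • u) - f x) - y)) := by
            rw [hsplit]; exact map_add_le_add _ _ _
        _ = q (f x - t • y) + s * q (s⁻¹ • (f (x + s • u) - f x) - y) := by
            rw [map_smul_eq_mul q, Real.norm_of_nonneg hs0.le]
        _ ≤ ε * t + s * ε := by gcongr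
        _ = ε * (t + s) := by ring
  have hle : t + s ≤ t := hmax hmem
  linarith

/-- Heine–Borel variant of the main theorem: `X`, `Y` real vector spaces
with sequences of norms, complete w.r.t. the metrics
`ρ(x,y) = max_n 2⁻ⁿ‖x−y‖ₙ/(1+‖x−y‖ₙ)`, both with the Heine–Borel property. If
`f : X → Y` is continuous, directionally differentiable, `f(0) = 0`, and for all `x, v`
there is `u` with `f'(x;u) = v` and `‖u‖ₙ ≤ cₙ|v|_{n+d}`, then every `y ∈ Y` has a
preimage `x` with `f(x) = y` and `‖x‖ₙ ≤ cₙ|y|_{n+d}`. -/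
theorem nash_moser_ekeland_heineBorel {X Y : Type}
    [AddCommGroup X] [Module ℝ X] [MetricSpace X] [CompleteSpace X]
    [AddCommGroup Y] [Module ℝ Y] [MetricSpace Y] [CompleteSpace Y]
    (N : ℕ → X → ℝ)
    (N_nonneg : ∀ n (x : X), 0 ≤ N n x)
    (N_eq_zero : ∀ n (x : X), N n x = 0 ↔ x = 0)
    (N_smul : ∀ n (a : ℝ) (x : X), N n (a • x) = |a| * N n x)
    (N_add : ∀ n (x y : X), N n (x + y) ≤ N n x + N n y)
    (M : ℕ → Y → ℝ)
    (M_nonneg : ∀ n (x : Y), 0 ≤ M n x)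
    (M_eq_zero : ∀ n (x : Y), M n x = 0 ↔ x = 0)
    (M_smul : ∀ n (a : ℝ) (x : Y), M n (a • x) = |a| * M n x)
    (M_add : ∀ n (x y : Y), M n (x + y) ≤ M n x + M n y)
    (hdistX : ∀ x y : X, IsGreatest
      (Set.range fun n : ℕ => (2 : ℝ)⁻¹ ^ n * (N n (x - y) / (1 + N n (x - y))))
      (dist x y))
    (hdistY : ∀ x y : Y, IsGreatest
      (Set.range fun n : ℕ => (2 : ℝ)⁻¹ ^ n * (M n (x - y) / (1 + M n (x - y))))
      (dist x y))
    (hHBX : ∀ C : Set X, IsClosed C → (∀ n, ∃ R : ℝ, ∀ x ∈ C, N n x ≤ R) → IsCompact C)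
    (hHBY : ∀ C : Set Y, IsClosed C → (∀ n, ∃ R : ℝ, ∀ y ∈ C, M n y ≤ R) → IsCompact C)
    (f : X → Y) (hf : Continuous f) (hf0 : f 0 = 0)
    (D : X → X → Y)
    (hD : ∀ x h : X,
      Tendsto (fun t : ℝ => t⁻¹ • (f (x + t • h) - f x)) (𝓝[>] (0 : ℝ)) (𝓝 (D x h)))
    (c : ℕ → ℝ) (hc : ∀ n, 0 < c n) (d : ℕ)
    (hsol : ∀ x : X, ∀ v : Y, ∃ u : X, D x u = v ∧ ∀ n, N n u ≤ c n * M (n + d) v)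
    (y : Y) :
    ∃ x : X, f x = y ∧ ∀ n, N n x ≤ c n * M (n + d) y := by
  let P : ℕ → Seminorm ℝ X := fun n => Seminorm.of (N n) (N_add n) (N_smul n)
  let q : Seminorm ℝ Y := Seminorm.of (M 0) (M_add 0) (M_smul 0)
  have hP : ∀ n, Continuous (P n) := fun n =>
    (P n).continuous_of_tendsto_sub <| tendsto_sub_of_weighted_le_dist (N_nonneg n) n
      fun x z => (hdistX x z).2 ⟨n, rfl⟩
  have hq_sub : ∀ b, Tendsto (fun a => q (a - b)) (𝓝 b) (𝓝 0) :=
    tendsto_sub_of_weighted_le_dist (M_nonneg 0) 0 fun x z => (hdistY x z).2 ⟨0, rfl⟩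
  have hf_sub : ∀ x, Tendsto (fun z => q (f z - f x)) (𝓝 x) (𝓝 0) := fun x =>
    (hq_sub (f x)).comp (hf.tendsto x)
  have hb : ∀ n, 0 ≤ c n * M (n + d) y := fun n => mul_nonneg (hc n).le (M_nonneg _ _)
  have hC : IsCompact {x | ∀ n, P n x ≤ c n * M (n + d) y} := by
    refine hHBX _ ?_ fun n => ⟨_, fun x hx => hx n⟩
    simp only [Set.ofPred_forall]
    exact isClosed_iInter fun n => isClosed_le (hP n) continuous_const
  have hstep : ∀ x, ∃ u, (∀ n, P n u ≤ c n * M (n + d) y) ∧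
      Tendsto (fun t : ℝ => q (t⁻¹ • (f (x + t • u) - f x) - y)) (𝓝[>] 0) (𝓝 0) := fun x => by
    obtain ⟨u, hu, huN⟩ := hsol x y
    exact ⟨u, huN, (hq_sub y).comp (hu ▸ hD x u)⟩
  have hcont : Continuous fun x => q (f x - y) := by
    refine continuous_iff_continuousAt.2 fun x => tendsto_iff_dist_tendsto_zero.2 ?_
    refine squeeze_zero (fun _ => dist_nonneg) (fun z => ?_) (hf_sub x)
    simpa [Real.dist_eq] using abs_sub_map_le_sub q (f z - y) (f x - y)
  obtain ⟨x, hx, hmin⟩ := hC.exists_isMinOn ⟨0, fun n => by simpa using hb n⟩ hcont.continuousOn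
  have hle : q (f x - y) ≤ 0 := le_of_forall_pos_le_add fun ε hε => by
    obtain ⟨z, hz, hzq⟩ := exists_approx_preimage hP hf_sub hf0 hb hC hstep hε
    simpa using (hmin hz).trans hzq
  exact ⟨x, sub_eq_zero.1 ((M_eq_zero 0 _).1 (hle.antisymm (M_nonneg 0 _))), hx⟩
end
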